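/- Let X be a finite-dimensional complex Banach space and T a nonzero operator such that M_{W(T)} = { (μx₀, conj(μ)x₀*) : |μ| = 1 } for some fixed pair (x₀, x₀*) with x₀*(x₀) = 1. Then T is nu-smooth: numerical-radius Birkhoff–James orthogonality is right-additive at T. -/

import Mathlib

/-- The numerical radius of a bounded linear operator on a complex space. -/
noncomputable def nrad {X : Type*} [NormedAddCommGroup X] [NormedSpace ℂ X]
    (T : X →L[ℂ] X) : ℝ :=
  sSup {r : ℝ | ∃ (x : X) (f : X →L[ℂ] ℂ), ‖x‖ = 1 ∧ ‖f‖ = 1 ∧ f x = 1 ∧ r = ‖f (T x)‖}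

/-- The numerical radius attainment set of `T`. -/
noncomputable def MW {X : Type*} [NormedAddCommGroup X] [NormedSpace ℂ X]
    (T : X →L[ℂ] X) : Set (X × (X →L[ℂ] ℂ)) :=
  {p | ‖p.1‖ = 1 ∧ ‖p.2‖ = 1 ∧ p.2 p.1 = 1 ∧ ‖p.2 (T p.1)‖ = nrad T}

open Filter Topology

/-- On a compact set, moving `F` along a direction `G` that points inwards wherever `‖F‖` attains
its bound `w` brings the norm strictly below `w`. -/
theorem IsCompact.exists_pos_forall_norm_add_smul_lt {E V : Type*} [TopologicalSpace E]
    [FirstCountableTopology E] [NormedAddCommGroup V] [InnerProductSpace ℝ V] {K : Set E}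
    (hK : IsCompact K) {F G : E → V} (hF : Continuous F) (hG : Continuous G) {w : ℝ}
    (hw : ∀ p ∈ K, ‖F p‖ ≤ w) (hinner : ∀ p ∈ K, ‖F p‖ = w → inner ℝ (F p) (G p) < 0) :
    ∃ s : ℝ, 0 < s ∧ ∀ p ∈ K, ‖F p + s • G p‖ < w := by
  by_contra! hcon
  choose p hpK hp using fun n : ℕ => hcon (1 / ((n : ℝ) + 1)) Nat.one_div_pos_of_nat
  obtain ⟨q, hqK, φ, hφ, hlim⟩ := hK.tendsto_subseq hpK
  have hs : Tendsto (fun n : ℕ => 1 / ((φ n : ℝ) + 1)) atTop (𝓝 0) :=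
    tendsto_one_div_add_atTop_nhds_zero_nat.comp hφ.tendsto_atTop
  have hFl := (hF.tendsto q).comp hlim
  have hGl := (hG.tendsto q).comp hlim
  have hq : w ≤ ‖F q‖ := by
    have h := (hFl.add (hs.smul hGl)).norm
    rw [zero_smul, add_zero] at h
    exact ge_of_tendsto' h fun n => hp (φ n)
  have hneg := hinner q hqK (le_antisymm (hw q hqK) hq)
  have hl := ((hFl.inner (𝕜 := ℝ) hGl).const_mul 2).add (hs.mul (hGl.norm.pow 2))
  obtain ⟨n, hn⟩ := (hl.eventually_lt_const 
    (show 2 * inner ℝ (F q) (G q) + 0 * ‖G q‖ ^ 2 < 0 by linarith)).exists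
  simp only [Function.comp_apply] at hn
  set s : ℝ := 1 / ((φ n : ℝ) + 1)
  have hspos : 0 < s := Nat.one_div_pos_of_nat
  have h1 := norm_add_sq_real (F (p (φ n))) (s • G (p (φ n)))
  rw [real_inner_smul_right, norm_smul, Real.norm_of_nonneg hspos.le] at h1
  have h2 : ‖F (p (φ n))‖ ^ 2 ≤ w ^ 2 :=
    pow_le_pow_left₀ (norm_nonneg _) (hw _ (hpK _)) 2
  have h3 : w ^ 2 ≤ ‖F (p (φ n)) + s • G (p (φ n))‖ ^ 2 :=
    pow_le_pow_left₀ ((norm_nonneg _).trans (hw _ (hpK 0))) (hp _) 2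
  nlinarith [mul_pos hspos (neg_pos.2 hn)]

section NumericalRadius

variable {X : Type*} [NormedAddCommGroup X] [NormedSpace ℂ X]

/-- The pairs of a unit vector and a unit functional that supports the unit ball there. -/
def supportPairs (X : Type*) [NormedAddCommGroup X] [NormedSpace ℂ X] : Set (X × (X →L[ℂ] ℂ)) :=
  {p | ‖p.1‖ = 1 ∧ ‖p.2‖ = 1 ∧ p.2 p.1 = 1}

theorem isCompact_supportPairs [FiniteDimensional ℂ X] : IsCompact (supportPairs X) := by
  have : ProperSpace X := FiniteDimensional.proper ℂ X
  have : ProperSpace (X →L[ℂ] ℂ) := FiniteDimensional.proper ℂ _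
  refine ((isCompact_sphere (0 : X) 1).prod (isCompact_sphere (0 : X →L[ℂ] ℂ) 1)).of_isClosed_subset
    ?_ ?_
  · exact (isClosed_eq (by fun_prop) (by fun_prop)).inter
      ((isClosed_eq (by fun_prop) (by fun_prop)).inter (isClosed_eq (by fun_prop) (by fun_prop)))
  · rintro p ⟨h1, h2, -⟩
    simp [h1, h2]

theorem norm_apply_le_nrad (T : X →L[ℂ] X) {p : X × (X →L[ℂ] ℂ)} (hp : p ∈ supportPairs X) :
    ‖p.2 (T p.1)‖ ≤ nrad T := by
  refine le_csSup ⟨‖T‖, ?_⟩ ⟨p.1, p.2, hp.1, hp.2.1, hp.2.2, rfl⟩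
  rintro r ⟨x, f, hx, hf, -, rfl⟩
  simpa [hx, hf] using f.le_of_opNorm_le_of_le le_rfl (T.le_opNorm x)

theorem nrad_nonneg (T : X →L[ℂ] X) : 0 ≤ nrad T :=
  Real.sSup_nonneg (by rintro r ⟨x, f, -, -, -, rfl⟩; exact norm_nonneg _)

theorem nrad_lt_of_forall_lt [FiniteDimensional ℂ X] (hne : (supportPairs X).Nonempty)
    {T : X →L[ℂ] X} {w : ℝ} (h : ∀ p ∈ supportPairs X, ‖p.2 (T p.1)‖ < w) : nrad T < w := by
  obtain ⟨p, hp, hmax⟩ := isCompact_supportPairs.exists_isMaxOn hne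
    (f := fun p : X × (X →L[ℂ] ℂ) => ‖p.2 (T p.1)‖) (by fun_prop)
  suffices nrad T ≤ ‖p.2 (T p.1)‖ from this.trans_lt (h p hp)
  refine csSup_le ⟨_, p.1, p.2, hp.1, hp.2.1, hp.2.2, rfl⟩ ?_
  rintro r ⟨x, f, hx, hf, hfx, rfl⟩
  exact hmax (show (x, f) ∈ supportPairs X from ⟨hx, hf, hfx⟩)

/-- If the numerical radius of `T` is attained only at the rotations of `(x₀, f₀)`, then every
operator to which `T` is numerical-radius orthogonal satisfies `f₀ (A x₀) = 0`. -/
theorem apply_eq_zero_of_nrad_le [FiniteDimensional ℂ X] {T A : X →L[ℂ] X} (hT : 0 < nrad T)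
    {x₀ : X} {f₀ : X →L[ℂ] ℂ} (h₀ : (x₀, f₀) ∈ MW T)
    (hM : ∀ p ∈ MW T, ∃ μ : ℂ, ‖μ‖ = 1 ∧ p = (μ • x₀, (starRingEnd ℂ) μ • f₀))
    (hA : ∀ lam : ℂ, nrad T ≤ nrad (T + lam • A)) : f₀ (A x₀) = 0 := by
  by_contra ha
  obtain ⟨hx, hf, hfx, h₀T⟩ := h₀
  set c : ℂ := -(f₀ (T x₀) / f₀ (A x₀))
  have hmem : ∀ p ∈ supportPairs X, ‖p.2 (T p.1)‖ = nrad T →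
      inner ℝ (p.2 (T p.1)) (p.2 ((c • A) p.1)) < 0 := by
    intro p hp hpT
    obtain ⟨μ, hμ, rfl⟩ := hM p ⟨hp.1, hp.2.1, hp.2.2, hpT⟩
    have hμ2 : μ * (starRingEnd ℂ) μ = 1 := by
      rw [Complex.mul_conj, Complex.normSq_eq_norm_sq, hμ]; simp
    have hval : ∀ S : X →L[ℂ] X,
        ((starRingEnd ℂ) μ • f₀) (S (μ • x₀)) = f₀ (S x₀) := fun S => by
      simp [← mul_assoc, hμ2]
    have hc : f₀ ((c • A) x₀) = -f₀ (T x₀) := by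
      simp [c, ha]
    simp only [hval] at hpT ⊢
    rw [hc, inner_neg_right, real_inner_self_eq_norm_sq, hpT]
    exact neg_lt_zero.2 (pow_pos hT 2)
  obtain ⟨s, -, hs⟩ := isCompact_supportPairs.exists_pos_forall_norm_add_smul_lt
    (F := fun p : X × (X →L[ℂ] ℂ) => p.2 (T p.1)) (G := fun p => p.2 ((c • A) p.1))
    (by fun_prop) (by fun_prop) (fun p hp => norm_apply_le_nrad T hp) hmem
  refine (hA (s * c)).not_gt
    (nrad_lt_of_forall_lt ⟨(x₀, f₀), hx, hf, hfx⟩ fun p hp => ?_)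
  simpa [mul_assoc] using hs p hp

end NumericalRadius

/-- on a finite-dimensional complex Banach space, if
`M_{W(T)} = { (μx₀, conj(μ)x₀*) : |μ| = 1 }` for a fixed pair `(x₀, x₀*)`, then `T`
is nu-smooth. -/
theorem nu_smooth_of_single_attainment (X : Type*) [NormedAddCommGroup X]
    [NormedSpace ℂ X] [FiniteDimensional ℂ X] (T : X →L[ℂ] X) (hT : T ≠ 0)
    (x₀ : X) (f₀ : X →L[ℂ] ℂ) (hx₀ : ‖x₀‖ = 1) (hf₀ : ‖f₀‖ = 1) (hfx : f₀ x₀ = 1)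
    (hM : MW T = {p | ∃ μ : ℂ, ‖μ‖ = 1 ∧ p = (μ • x₀, (starRingEnd ℂ) μ • f₀)}) :
    ∀ A B : X →L[ℂ] X, (∀ lam : ℂ, nrad T ≤ nrad (T + lam • A)) →
      (∀ lam : ℂ, nrad T ≤ nrad (T + lam • B)) →
      (∀ lam : ℂ, nrad T ≤ nrad (T + lam • (A + B))) := by
  intro A B hA hB lam
  rcases (nrad_nonneg T).eq_or_lt with h0 | hpos
  · exact h0 ▸ nrad_nonneg _
  have h₀ : (x₀, f₀) ∈ MW T := by
    rw [hM]
    exact ⟨1, by simp, by simp⟩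
  have hM' := fun p (hp : p ∈ MW T) => hM.subset hp
  have ha := apply_eq_zero_of_nrad_le hpos h₀ hM' hA
  have hb := apply_eq_zero_of_nrad_le hpos h₀ hM' hB
  have h := norm_apply_le_nrad (T + lam • (A + B))
    (show (x₀, f₀) ∈ supportPairs X from ⟨hx₀, hf₀, hfx⟩)
  simpa [ha, hb, h₀.2.2.2] using h
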